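/- arXiv:1603.06547 — 2 statements merged into one kernel-verified Lean document; each statement's English description precedes it below -/
import Mathlib

section
/- If A is a dense and compact bounded sublattice of a complete lattice C and f : A → A is monotone and preserves nonempty finite joins (f(a ⊔ b) = f(a) ⊔ f(b) for all a, b ∈ A), then its σ-extension preserves arbitrary nonempty joins: f^σ(⨆U) = ⨆{ f^σ(u) : u ∈ U } for every nonempty subset U of C. -/
/-- `A` is a bounded sublattice of the complete lattice `C`: it is closed under binary
meets and joins and contains `⊥` and `⊤`. -/
def IsBddSublattice {C : Type*} [CompleteLattice C] (A : Set C) : Prop :=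
  (∀ a ∈ A, ∀ b ∈ A, a ⊓ b ∈ A) ∧ (∀ a ∈ A, ∀ b ∈ A, a ⊔ b ∈ A) ∧ ⊥ ∈ A ∧ ⊤ ∈ A

/-- `A` is dense in `C`: every element of `C` is both a join of meets and a meet of
joins of elements of `A`. -/
def IsDenseIn {C : Type*} [CompleteLattice C] (A : Set C) : Prop :=
  ∀ u : C,
    (∃ 𝒮 : Set (Set C), (∀ S ∈ 𝒮, S ⊆ A) ∧ u = sSup (sInf '' 𝒮)) ∧
    (∃ 𝒯 : Set (Set C), (∀ T ∈ 𝒯, T ⊆ A) ∧ u = sInf (sSup '' 𝒯))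

/-- `A` is compact in `C`: whenever a meet of elements of `A` lies below a join of
elements of `A`, some finite sub-meet lies below some finite sub-join. -/
def IsCompactIn {C : Type*} [CompleteLattice C] (A : Set C) : Prop :=
  ∀ S T : Set C, S ⊆ A → T ⊆ A → sInf S ≤ sSup T →
    ∃ S' T' : Finset C, ↑S' ⊆ S ∧ ↑T' ⊆ T ∧ sInf (S' : Set C) ≤ sSup (T' : Set C)


/-- The closed elements of `C` relative to `A`: meets of arbitrary subsets of `A`. -/
def closedEls {C : Type*} [CompleteLattice C] (A : Set C) : Set C :=
  {k | ∃ S ⊆ A, k = sInf S}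

/-- The open elements of `C` relative to `A`: joins of arbitrary subsets of `A`. -/
def openEls {C : Type*} [CompleteLattice C] (A : Set C) : Set C :=
  {o | ∃ S ⊆ A, o = sSup S}

/-- The σ-extension of a monotone map `f` defined on the sublattice `A`:
`f^σ(u) = ⨆ { ⨅ { f a : a ∈ A, k ≤ a } : k ∈ K(C), k ≤ u }`. -/
def sigmaExt {C : Type*} [CompleteLattice C] (A : Set C) (f : C → C) (u : C) : C :=
  sSup {v | ∃ k ∈ closedEls A, k ≤ u ∧ v = sInf (f '' {a ∈ A | k ≤ a})}

/-- The π-extension of a monotone map `f` defined on the sublattice `A`: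
`f^π(u) = ⨅ { ⨆ { f a : a ∈ A, a ≤ o } : o ∈ O(C), u ≤ o }`. -/
def piExt {C : Type*} [CompleteLattice C] (A : Set C) (f : C → C) (u : C) : C :=
  sInf {v | ∃ o ∈ openEls A, u ≤ o ∧ v = sSup (f '' {a ∈ A | a ≤ o})}

/-- A finite subset of the image of the filter of elements of `A` above `p` is bounded below
by a single element of that image. -/
theorem IsBddSublattice.exists_map_le_sInf {C : Type*} [CompleteLattice C] {A : Set C}
    (hA : IsBddSublattice A) {f : C → C}
    (hmono : ∀ a ∈ A, ∀ b ∈ A, a ≤ b → f a ≤ f b) (p : C) (S : Finset C)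
    (hS : (S : Set C) ⊆ f '' {a ∈ A | p ≤ a}) :
    ∃ a ∈ A, p ≤ a ∧ f a ≤ sInf (S : Set C) := by
  classical
  induction S using Finset.induction_on with
  | empty => exact ⟨⊤, hA.2.2.2, le_top, by simp⟩
  | insert s S _ ih =>
    rw [Finset.coe_insert, Set.insert_subset_iff] at hS
    obtain ⟨⟨b, ⟨hb, hpb⟩, rfl⟩, hS⟩ := hS
    obtain ⟨a, ha, hpa, hfa⟩ := ih hS
    have hba := hA.1 b hb a ha
    refine ⟨b ⊓ a, hba, le_inf hpb hpa, ?_⟩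
    rw [Finset.coe_insert, sInf_insert]
    exact le_inf (hmono _ hba _ hb inf_le_left) ((hmono _ hba _ ha inf_le_right).trans hfa)

/-- If `f` preserves binary joins on `A`, then the elements of `A` that `f` sends below `o` are
closed under finite joins, as soon as `⊥` is one of them. -/
theorem IsBddSublattice.sSup_mem_and_map_le {C : Type*} [CompleteLattice C] {A : Set C}
    (hA : IsBddSublattice A) {f : C → C}
    (hsup : ∀ a ∈ A, ∀ b ∈ A, f (a ⊔ b) = f a ⊔ f b) {o : C} (hbot : f ⊥ ≤ o) (T : Finset C)
    (hT : (T : Set C) ⊆ {a ∈ A | f a ≤ o}) :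
    sSup (T : Set C) ∈ A ∧ f (sSup (T : Set C)) ≤ o := by
  classical
  induction T using Finset.induction_on with
  | empty => simpa using ⟨hA.2.2.1, hbot⟩
  | insert t T _ ih =>
    rw [Finset.coe_insert, Set.insert_subset_iff] at hT
    obtain ⟨⟨ht, hft⟩, hT⟩ := hT
    obtain ⟨h, hf⟩ := ih hT
    rw [Finset.coe_insert, sSup_insert, hsup _ ht _ h]
    exact ⟨hA.2.1 _ ht _ h, sup_le hft hf⟩

theorem sigmaExt_mono {C : Type*} [CompleteLattice C] (A : Set C) (f : C → C) :
    Monotone (sigmaExt A f) := fun _ _ huv =>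
  sSup_le_sSup fun _ ⟨k, hk, hku, h⟩ => ⟨k, hk, hku.trans huv, h⟩

/-- If the `σ`-extension of `f` at `u` lies below an open element `o`, then every closed `p ≤ u`
lies below some `a ∈ A` with `f a ≤ o`. -/
theorem exists_le_map_le_of_sigmaExt_le {C : Type*} [CompleteLattice C] {A : Set C}
    (hA : IsBddSublattice A) (hcompact : IsCompactIn A) {f : C → C} (hfA : ∀ a ∈ A, f a ∈ A)
    (hmono : ∀ a ∈ A, ∀ b ∈ A, a ≤ b → f a ≤ f b) {u p o : C} (ho : o ∈ openEls A)
    (hu : sigmaExt A f u ≤ o) (hp : p ∈ closedEls A) (hpu : p ≤ u) :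
    ∃ a ∈ A, p ≤ a ∧ f a ≤ o := by
  obtain ⟨T, hT, rfl⟩ := ho
  have hle : sInf (f '' {a ∈ A | p ≤ a}) ≤ sSup T := by
    refine le_trans (le_sSup ?_) hu
    exact ⟨p, hp, hpu, rfl⟩
  have hsub : f '' {a ∈ A | p ≤ a} ⊆ A := by
    rintro _ ⟨a, ha, rfl⟩
    exact hfA a ha.1
  obtain ⟨S', T', hS', hT', h⟩ := hcompact _ _ hsub hT hle
  obtain ⟨a, ha, hpa, hfa⟩ := hA.exists_map_le_sInf hmono p S' hS'
  exact ⟨a, ha, hpa, hfa.trans (h.trans (sSup_le_sSup hT'))⟩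

/-- If the monotone `f : A → A` preserves nonempty finite joins, then its σ-extension
preserves arbitrary nonempty joins. -/
theorem sigmaExt_preserves_nonempty_sSup {C : Type*} [CompleteLattice C] {A : Set C}
    (hA : IsBddSublattice A) (hdense : IsDenseIn A) (hcompact : IsCompactIn A)
    (f : C → C) (hfA : ∀ a ∈ A, f a ∈ A)
    (hmono : ∀ a ∈ A, ∀ b ∈ A, a ≤ b → f a ≤ f b)
    (hsup : ∀ a ∈ A, ∀ b ∈ A, f (a ⊔ b) = f a ⊔ f b) :
    ∀ U : Set C, U.Nonempty → sigmaExt A f (sSup U) = sSup (sigmaExt A f '' U) := by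
  rintro U ⟨u₀, hu₀⟩
  refine le_antisymm ?_ ?_
  · obtain ⟨𝒯, h𝒯, hsInf⟩ := (hdense (sSup (sigmaExt A f '' U))).2
    rw [hsInf]
    refine le_sInf ?_
    rintro _ ⟨T, hT, rfl⟩
    have ho : sSup T ∈ openEls A := ⟨T, h𝒯 T hT, rfl⟩
    have hU : ∀ u ∈ U, sigmaExt A f u ≤ sSup T := fun u hu =>
      (le_sSup (Set.mem_image_of_mem _ hu)).trans
        (hsInf.le.trans (sInf_le (Set.mem_image_of_mem _ hT)))
    have hbot_closed : (⊥ : C) ∈ closedEls A :=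
      ⟨{⊥}, Set.singleton_subset_iff.2 hA.2.2.1, sInf_singleton.symm⟩
    obtain ⟨b, hb, -, hfb⟩ := exists_le_map_le_of_sigmaExt_le hA hcompact hfA hmono ho
      (hU u₀ hu₀) hbot_closed bot_le
    have hbot : f ⊥ ≤ sSup T := (hmono _ hA.2.2.1 _ hb bot_le).trans hfb
    have hUle : sSup U ≤ sSup {a ∈ A | f a ≤ sSup T} := by
      refine sSup_le fun u hu => ?_
      obtain ⟨𝒮, h𝒮, hueq⟩ := (hdense u).1
      rw [hueq]
      refine sSup_le ?_
      rintro _ ⟨S, hS, rfl⟩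
      obtain ⟨a, ha, hpa, hfa⟩ := exists_le_map_le_of_sigmaExt_le hA hcompact hfA hmono ho
        (hU u hu) ⟨S, h𝒮 S hS, rfl⟩ (hueq ▸ le_sSup (Set.mem_image_of_mem _ hS))
      exact hpa.trans (le_sSup ⟨ha, hfa⟩)
    refine sSup_le ?_
    rintro _ ⟨_, ⟨S, hS, rfl⟩, hkU, rfl⟩
    obtain ⟨S', T', hS', hT', h⟩ :=
      hcompact S {a ∈ A | f a ≤ sSup T} hS (Set.sep_subset _ _) (hkU.trans hUle)
    obtain ⟨hmem, hle⟩ := hA.sSup_mem_and_map_le hsup hbot T' hT'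
    have hk : sSup (T' : Set C) ∈ {a ∈ A | sInf S ≤ a} := ⟨hmem, (sInf_le_sInf hS').trans h⟩
    exact (sInf_le (Set.mem_image_of_mem f hk)).trans hle
  · refine sSup_le ?_
    rintro _ ⟨u, hu, rfl⟩
    exact sigmaExt_mono A f (le_sSup hu)
end

section
/- If A is a dense and compact bounded sublattice of a complete lattice C and f : A → A is antitone and sends finite meets to finite joins (f(⊤) = ⊥ and f(a ⊓ b) = f(a) ⊔ f(b) for all a, b ∈ A), then its σ-extension f^σ : C → C, defined by f^σ(u) = ⨆{ ⨅{ f(a) : a ∈ A, a ≤ o } : o ∈ O(C), u ≤ o }, sends arbitrary meets to arbitrary joins: f^σ(⨅U) = ⨆{ f^σ(u) : u ∈ U } for every subset U of C. -/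
/-- The σ-extension of an antitone map `f` defined on the sublattice `A` (obtained by
regarding `f` as monotone on the order dual of `A`, so closed and open elements swap
roles): `f^σ(u) = ⨆ { ⨅ { f a : a ∈ A, a ≤ o } : o ∈ O(C), u ≤ o }`. -/
def sigmaExtAnti {C : Type*} [CompleteLattice C] (A : Set C) (f : C → C) (u : C) : C :=
  sSup {v | ∃ o ∈ openEls A, u ≤ o ∧ v = sInf (f '' {a ∈ A | a ≤ o})}

section

variable {C : Type*} [CompleteLattice C] {A : Set C}

theorem IsDenseIn.le_of_forall_openEls (hdense : IsDenseIn A) {u v : C}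
    (h : ∀ o ∈ openEls A, v ≤ o → u ≤ o) : u ≤ v := by
  obtain ⟨-, 𝒯, h𝒯, rfl⟩ := hdense v
  refine le_sInf ?_
  rintro _ ⟨T, hT, rfl⟩
  exact h _ ⟨T, h𝒯 T hT, rfl⟩ (sInf_le ⟨T, hT, rfl⟩)

theorem exists_le_finset_of_subset_image (hA : IsBddSublattice A) {f : C → C}
    (hanti : ∀ a ∈ A, ∀ b ∈ A, a ≤ b → f b ≤ f a) {o : C} (S : Finset C)
    (hS : ↑S ⊆ f '' {a ∈ A | a ≤ o}) : ∃ a ∈ A, a ≤ o ∧ f a ≤ sInf (S : Set C) := by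
  classical
  induction S using Finset.induction_on with
  | empty => exact ⟨⊥, hA.2.2.1, bot_le, by simp⟩
  | insert s S _ ih =>
    rw [Finset.coe_insert, Set.insert_subset_iff] at hS
    obtain ⟨⟨b, ⟨hb, hbo⟩, rfl⟩, hS⟩ := hS
    obtain ⟨a, ha, hao, has⟩ := ih hS
    have hab := hA.2.1 b hb a ha
    refine ⟨b ⊔ a, hab, sup_le hbo hao, ?_⟩
    rw [Finset.coe_insert, sInf_insert]
    exact le_inf (hanti b hb _ hab le_sup_left) ((hanti a ha _ hab le_sup_right).trans has)

theorem sInf_finset_mem_of_map_le (hA : IsBddSublattice A) {f : C → C} (htop : f ⊤ = ⊥)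
    (hinf : ∀ a ∈ A, ∀ b ∈ A, f (a ⊓ b) = f a ⊔ f b) {o : C} (S : Finset C)
    (hS : ↑S ⊆ {a ∈ A | f a ≤ o}) : sInf (S : Set C) ∈ {a ∈ A | f a ≤ o} := by
  classical
  induction S using Finset.induction_on with
  | empty => simpa [htop] using hA.2.2.2
  | insert s S _ ih =>
    rw [Finset.coe_insert, Set.insert_subset_iff] at hS
    obtain ⟨⟨hs, hso⟩, hS⟩ := hS
    obtain ⟨ha, hao⟩ := ih hS
    rw [Finset.coe_insert, sInf_insert]
    exact ⟨hA.1 _ hs _ ha, (hinf _ hs _ ha).trans_le (sup_le hso hao)⟩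

/-- On open elements the σ-extension satisfies a Galois condition: it lies below an open `o'`
exactly when the closed element generated by the filter `{a ∈ A | f a ≤ o'}` lies below the
argument. -/
theorem sigmaExtAnti_le_iff (hA : IsBddSublattice A) (hdense : IsDenseIn A)
    (hcompact : IsCompactIn A) {f : C → C} (hfA : ∀ a ∈ A, f a ∈ A)
    (hanti : ∀ a ∈ A, ∀ b ∈ A, a ≤ b → f b ≤ f a) (htop : f ⊤ = ⊥)
    (hinf : ∀ a ∈ A, ∀ b ∈ A, f (a ⊓ b) = f a ⊔ f b) {o' : C} (ho' : o' ∈ openEls A) {u : C} :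
    sigmaExtAnti A f u ≤ o' ↔ sInf {a ∈ A | f a ≤ o'} ≤ u := by
  constructor
  · intro h
    refine hdense.le_of_forall_openEls fun o ho huo => ?_
    obtain ⟨T, hT, rfl⟩ := ho'
    have hle : sInf (f '' {a ∈ A | a ≤ o}) ≤ sSup T := sSup_le_iff.1 h _ ⟨o, ho, huo, rfl⟩
    have hsub : f '' {a ∈ A | a ≤ o} ⊆ A := by
      rintro _ ⟨a, ha, rfl⟩
      exact hfA a ha.1
    obtain ⟨S', T', hS', hT', hST⟩ := hcompact _ T hsub hT hle
    obtain ⟨a, ha, hao, has⟩ := exists_le_finset_of_subset_image hA hanti S' hS'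
    exact le_trans (sInf_le ⟨ha, has.trans (hST.trans (sSup_le_sSup hT'))⟩) hao
  · intro h
    refine sSup_le ?_
    rintro _ ⟨_, ⟨T, hT, rfl⟩, huo, rfl⟩
    obtain ⟨S', T', hS', hT', hST⟩ := hcompact _ T (fun a ha => ha.1) hT (h.trans huo)
    obtain ⟨ha, hao⟩ := sInf_finset_mem_of_map_le hA htop hinf S' hS'
    exact le_trans (sInf_le ⟨_, ⟨ha, hST.trans (sSup_le_sSup hT')⟩, rfl⟩) hao

end

/-- If the antitone `f : A → A` sends finite meets to finite joins, then its σ-extension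
sends arbitrary meets to arbitrary joins. -/
theorem sigmaExtAnti_sInf_to_sSup {C : Type*} [CompleteLattice C] {A : Set C}
    (hA : IsBddSublattice A) (hdense : IsDenseIn A) (hcompact : IsCompactIn A)
    (f : C → C) (hfA : ∀ a ∈ A, f a ∈ A)
    (hanti : ∀ a ∈ A, ∀ b ∈ A, a ≤ b → f b ≤ f a)
    (htop : f ⊤ = ⊥)
    (hinf : ∀ a ∈ A, ∀ b ∈ A, f (a ⊓ b) = f a ⊔ f b) :
    ∀ U : Set C, sigmaExtAnti A f (sInf U) = sSup (sigmaExtAnti A f '' U) := by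
  intro U
  have key : ∀ o' ∈ openEls A, sigmaExtAnti A f (sInf U) ≤ o' ↔
      sSup (sigmaExtAnti A f '' U) ≤ o' := by
    intro o' ho'
    simp only [sSup_le_iff, Set.forall_mem_image,
      sigmaExtAnti_le_iff hA hdense hcompact hfA hanti htop hinf ho', le_sInf_iff]
  apply le_antisymm
  · exact hdense.le_of_forall_openEls fun o' ho' h => (key o' ho').2 h
  · exact hdense.le_of_forall_openEls fun o' ho' h => (key o' ho').1 h
end
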